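/- Let ε > 0 and let 𝓛 = {L_i}_{i∈ℕ} be a countable collection of infinite subsets of ℕ that contains two distinct languages L_a ≠ L_b with L_a ∩ L_b infinite and L_a \ L_b finite. Then there is no prefix-causal map A from input streams to probability measures on index streams that is ε-differentially private in the continual release model and identifies 𝓛 in the limit; that is, no such A satisfies: for every index i and every enumeration e of L_i, A(e)({w : there exists n* such that for all n ≥ n*, L_{w(n)} = L_i}) = 1. -/

import Mathlib

open MeasureTheory

/-- Two streams are neighboring if they differ in exactly one coordinate. -/
def Neighboring (x x' : ℕ → ℕ) : Prop :=
  ∃ j, x j ≠ x' j ∧ ∀ m, m ≠ j → x m = x' m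

/-- A continual-release algorithm is prefix-causal if streams agreeing on their
first `n` coordinates induce the same distribution on the first `n` outputs. -/
def PrefixCausal (A : (ℕ → ℕ) → Measure (ℕ → ℕ)) : Prop :=
  ∀ x x' : ℕ → ℕ, ∀ n : ℕ, (∀ m < n, x m = x' m) →
    (A x).map (fun w (m : Fin n) => w m.val) = (A x').map (fun w (m : Fin n) => w m.val)

/-- ε-differential privacy in the continual release model. -/
def DPCR (ε : ℝ) (A : (ℕ → ℕ) → Measure (ℕ → ℕ)) : Prop :=
  ∀ x x' : ℕ → ℕ, Neighboring x x' → ∀ E : Set (ℕ → ℕ), MeasurableSet E →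
    A x E ≤ ENNReal.ofReal (Real.exp ε) * A x' E

/-- An enumeration of a language `K`. -/
def IsEnumeration (K : Set ℕ) (e : ℕ → ℕ) : Prop :=
  (∀ n, e n ∈ K) ∧ ∀ y ∈ K, ∃ n, e n = y

/-- Group privacy at the level of null sets: changing finitely many inputs preserves null sets. -/
lemma DPCR.null_of_eq_off_finset {ε : ℝ} {A : (ℕ → ℕ) → Measure (ℕ → ℕ)} (hA : DPCR ε A)
    {z : ℕ → ℕ} {E : Set (ℕ → ℕ)} (hE : MeasurableSet E) (hz : A z E = 0) (s : Finset ℕ) :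
    ∀ y : ℕ → ℕ, (∀ n ∉ s, y n = z n) → A y E = 0 := by
  induction s using Finset.induction_on with
  | empty =>
    intro y hy
    rwa [show y = z from funext fun n => hy n (by simp)]
  | insert k s _ ih =>
    intro y hy
    have h0 : A (Function.update y k (z k)) E = 0 := by
      refine ih _ fun n hn => ?_
      by_cases hnk : n = k
      · subst hnk; simp
      · rw [Function.update_of_ne hnk]
        exact hy n (by simp [hnk, hn])
    by_cases hk : y k = z k
    · rwa [← hk, Function.update_eq_self] at h0
    · have hN : Neighboring y (Function.update y k (z k)) :=
        ⟨k, by simpa using hk, fun m hm => by rw [Function.update_of_ne hm]⟩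
      have := hA _ _ hN E hE
      rwa [h0, mul_zero, nonpos_iff_eq_zero] at this

lemma DPCR.null_of_finite_ne {ε : ℝ} {A : (ℕ → ℕ) → Measure (ℕ → ℕ)} (hA : DPCR ε A)
    {y z : ℕ → ℕ} (hyz : {n | y n ≠ z n}.Finite) {E : Set (ℕ → ℕ)} (hE : MeasurableSet E)
    (hz : A z E = 0) : A y E = 0 :=
  hA.null_of_eq_off_finset hE hz hyz.toFinset y fun n hn => by simpa using hn

lemma measurableSet_apply_mem (S : Set ℕ) (m : ℕ) :
    MeasurableSet {w : ℕ → ℕ | w m ∈ S} :=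
  measurable_pi_apply m (MeasurableSet.of_discrete (s := S))

lemma measurableSet_eventually_mem (S : Set ℕ) :
    MeasurableSet {w : ℕ → ℕ | ∃ N : ℕ, ∀ n ≥ N, w n ∈ S} := by
  simp only [Set.ofPred_exists, Set.ofPred_forall]
  exact .iUnion fun N => .iInter fun n => .iInter fun _ => measurableSet_apply_mem S n

/-- If a random sequence is almost surely eventually in `S`, each late enough term is in `S`
with probability more than one half. -/
lemma exists_forall_half_lt_measure_mem {μ : Measure (ℕ → ℕ)} {S : Set ℕ}
    (h : μ {w | ∃ N : ℕ, ∀ n ≥ N, w n ∈ S} = 1) :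
    ∃ N : ℕ, ∀ m ≥ N, 1 / 2 < μ {w | w m ∈ S} := by
  have hmono : Monotone fun N : ℕ => {w : ℕ → ℕ | ∀ n ≥ N, w n ∈ S} :=
    fun M N hMN w hw n hn => hw n (hMN.trans hn)
  have ht := tendsto_measure_iUnion_atTop (μ := μ) hmono
  rw [← Set.ofPred_exists, h] at ht
  obtain ⟨N, hN⟩ := (ht.eventually (lt_mem_nhds (b := 1) ENNReal.one_half_lt_one)).exists
  have hN' : 1 / 2 < μ {w : ℕ → ℕ | ∀ n ≥ N, w n ∈ S} := by simpa using hN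
  exact ⟨N, fun m hm => hN'.trans_le (measure_mono fun w hw => hw m hm)⟩

lemma PrefixCausal.measure_mem_eq {A : (ℕ → ℕ) → Measure (ℕ → ℕ)} (hA : PrefixCausal A)
    {x y : ℕ → ℕ} {m : ℕ} (hxy : ∀ n < m + 1, x n = y n) (S : Set ℕ) :
    A x {w | w m ∈ S} = A y {w | w m ∈ S} := by
  have hmeas : Measurable fun (w : ℕ → ℕ) (k : Fin (m + 1)) => w k.val := by fun_prop
  have hT : MeasurableSet {v : Fin (m + 1) → ℕ | v (Fin.last m) ∈ S} :=
    measurable_pi_apply (Fin.last m) (MeasurableSet.of_discrete (s := S))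
  have := congrArg (fun μ : Measure (Fin (m + 1) → ℕ) => μ {v | v (Fin.last m) ∈ S}) (hA x y (m + 1) hxy)
  simpa only [Measure.map_apply hmeas hT, Set.preimage_ofPred_eq, Fin.val_last] using this

/-- Diagonal construction: if every finite modification `y` of `z` satisfies `Q y m` for
arbitrarily large `m`, then the values of `h` can be inserted one by one into `z` so that the
resulting stream agrees infinitely often with such a `y` up to such an `m`. -/
lemma exists_stream_diagonal (z h : ℕ → ℕ) (Q : (ℕ → ℕ) → ℕ → Prop)
    (hQ : ∀ y : ℕ → ℕ, {n | y n ≠ z n}.Finite → ∀ n, ∃ m ≥ n, Q y m) :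
    ∃ x : ℕ → ℕ, (∀ j, ∃ n, x n = h j) ∧ (∀ n, x n = z n ∨ x n ∈ Set.range h) ∧
      ∀ N, ∃ y, ∃ m ≥ N, (∀ n < m + 1, x n = y n) ∧ Q y m := by
  choose! M hM hMQ using hQ
  let s : ℕ → (ℕ → ℕ) × ℕ := fun j => j.rec (z, 0) fun i p =>
    (Function.update p.1 p.2 (h i), M (Function.update p.1 p.2 (h i)) p.2 + 1)
  have s1 (j) : (s (j + 1)).1 = Function.update (s j).1 (s j).2 (h j) := rfl
  have s2 (j) : (s (j + 1)).2 = M (s (j + 1)).1 (s j).2 + 1 := rfl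
  have hfin (j) : {n | (s j).1 n ≠ z n}.Finite := by
    induction j with
    | zero => simp [s]
    | succ j ih =>
      refine (ih.insert (s j).2).subset fun n hn => ?_
      by_cases hnj : n = (s j).2
      · exact Or.inl hnj
      · right
        simpa [s1, Function.update_of_ne hnj] using hn
  have hlt (j) : (s j).2 < (s (j + 1)).2 := by
    rw [s2]
    exact Nat.lt_succ_of_le (hM _ (hfin (j + 1)) _)
  have hmono : StrictMono fun j => (s j).2 := strictMono_nat_of_lt_succ hlt
  have hstable (j k n) (hjk : j ≤ k) (hn : n < (s j).2) : (s k).1 n = (s j).1 n := by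
    induction k, hjk using Nat.le_induction with
    | base => rfl
    | succ k hjk ih =>
      rw [s1, Function.update_of_ne (hn.trans_le (hmono.monotone hjk)).ne, ih]
  have hval (j n) : (s j).1 n = z n ∨ (s j).1 n ∈ Set.range h := by
    induction j with
    | zero => exact Or.inl rfl
    | succ j ih =>
      by_cases hnj : n = (s j).2
      · right
        simp [s1, hnj]
      · rwa [s1, Function.update_of_ne hnj]
  have hagree (j n) (hn : n < (s j).2) : (s (n + 1)).1 n = (s j).1 n := by
    rcases le_total (n + 1) j with hj | hj
    · exact (hstable _ _ _ hj (hmono.le_apply (x := n + 1))).symm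
    · exact hstable _ _ _ hj hn
  refine ⟨fun n => (s (n + 1)).1 n, fun j => ⟨(s j).2, ?_⟩, fun n => hval (n + 1) n, fun N => ?_⟩
  · simp only [hagree (j + 1) _ (hlt j)]
    simp [s1]
  · refine ⟨(s (N + 1)).1, M (s (N + 1)).1 (s N).2, ?_, fun n hn => hagree (N + 1) n hn,
      hMQ _ (hfin (N + 1)) _⟩
    exact (hmono.le_apply (x := N)).trans (hM _ (hfin (N + 1)) _)

/-- private identification barrier: If a countable collection of
infinite languages contains two distinct languages with infinite intersection
and finite set difference, then no prefix-causal ε-DP continual-release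
algorithm identifies the collection in the limit. -/
theorem stmt11 (ε : ℝ) (hε : 0 < ε) (L : ℕ → Set ℕ) (hL : ∀ i, (L i).Infinite)
    (a b : ℕ) (hab : L a ≠ L b) (hInter : (L a ∩ L b).Infinite)
    (hDiff : (L a \ L b).Finite) :
    ¬ ∃ A : (ℕ → ℕ) → Measure (ℕ → ℕ),
        (∀ x, IsProbabilityMeasure (A x)) ∧ PrefixCausal A ∧ DPCR ε A ∧
        ∀ i : ℕ, ∀ e : ℕ → ℕ, IsEnumeration (L i) e →
          A e {w | ∃ nstar : ℕ, ∀ n ≥ nstar, L (w n) = L i} = 1 := by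
  classical
  rintro ⟨A, hprob, hcausal, hdp, hid⟩
  let e : ℕ → ℕ := Nat.nth (· ∈ L a)
  have he : IsEnumeration (L a) e :=
    ⟨Nat.nth_mem_of_infinite (hL a), fun y hy => ⟨_, Nat.nth_count hy⟩⟩
  obtain ⟨c, -, hcb⟩ := hInter.nonempty
  obtain ⟨h, hh⟩ := (Set.to_countable (L b)).exists_eq_range (hL b).nonempty
  let z : ℕ → ℕ := fun n => if e n ∈ L b then e n else c
  have hzb (n) : z n ∈ L b := by
    by_cases hn : e n ∈ L b <;> simp [z, hn, hcb]
  have hze : {n | z n ≠ e n}.Finite := by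
    refine (hDiff.preimage (Nat.nth_injective (hL a)).injOn).subset fun n hn => ?_
    refine ⟨he.1 n, fun hb => hn ?_⟩
    simp only [z]
    exact if_pos hb
  have hconv (y : ℕ → ℕ) (hy : {n | y n ≠ z n}.Finite) :
      A y {w | ∃ N : ℕ, ∀ n ≥ N, w n ∈ {i | L i = L a}} = 1 := by
    have hye : {n | y n ≠ e n}.Finite := (hy.union hze).subset fun n hn => by
      by_contra hcon
      simp only [Set.mem_union, Set.mem_ofPred_eq, not_or, not_not] at hcon
      exact hn (hcon.1.trans hcon.2)
    have hm := measurableSet_eventually_mem {i | L i = L a}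
    rw [← prob_compl_eq_zero_iff hm]
    exact hdp.null_of_finite_ne hye hm.compl ((prob_compl_eq_zero_iff hm).2 (hid a e he))
  obtain ⟨x, hxh, hxz, hx⟩ := exists_stream_diagonal z h
    (fun y m => 1 / 2 < A y {w | w m ∈ {i | L i = L a}}) fun y hy n => by
      obtain ⟨N, hN⟩ := exists_forall_half_lt_measure_mem (hconv y hy)
      exact ⟨max n N, le_max_left _ _, hN _ (le_max_right _ _)⟩
  have hxb : IsEnumeration (L b) x := by
    refine ⟨fun n => ?_, fun y hy => ?_⟩
    · rcases hxz n with hn | hn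
      · exact hn ▸ hzb n
      · rwa [hh]
    · rw [hh] at hy
      obtain ⟨j, rfl⟩ := hy
      exact hxh j
  obtain ⟨N, hN⟩ := exists_forall_half_lt_measure_mem (S := {i | L i = L b}) (hid b x hxb)
  obtain ⟨y, m, hm, hxy, hy⟩ := hx N
  rw [← hcausal.measure_mem_eq hxy] at hy
  have hdisj : Disjoint {w : ℕ → ℕ | w m ∈ {i | L i = L a}} {w | w m ∈ {i | L i = L b}} :=
    Set.disjoint_left.2 fun w hwa hwb => hab (Eq.trans (Eq.symm hwa) hwb)
  have hsum := ENNReal.add_lt_add hy (hN m hm)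
  rw [← measure_union hdisj (measurableSet_apply_mem _ m), ENNReal.add_halves] at hsum
  exact hsum.not_ge prob_le_one
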